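/- Let a network N consist of M parties with finite input sets and N independent sources, each source being connected to a fixed subset of the parties. Suppose real coefficients β indexed by joint inputs (x¹,…,x^M) are such that every N-local model satisfies the full-correlation Bell inequality Σ_{x¹,…,x^M} β_{x¹,…,x^M} ⟨a¹_{x¹}⋯a^M_{x^M}⟩ ≤ 1. Form the network N′ by adding one new source S_{N+1} connected exactly to party A^M and to one new party A^{M+1}, where A^{M+1} has binary inputs x^{M+1} ∈ {0,1} and outputs ±1. Then every N′-local model satisfies: either there exists q ∈ (0,1) such that for every partition of party A^M's input set into two disjoint subsets X₊ and X₋ one has (1/q)·Σ_{X₊} + (1/(1−q))·Σ_{X₋} ≤ 1, where Σ_{X±} = Σ_{x¹,…,x^{M−1}, x^M ∈ X±} β_{x¹,…,x^M} ⟨a¹_{x¹}⋯a^M_{x^M}·(a^{M+1}_0 ± a^{M+1}_1)/2⟩; or for every such partition Σ_{X₋} = 0 and Σ_{X₊} ≤ 1; or for every such partition Σ_{X₊} = 0 and Σ_{X₋} ≤ 1. -/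

import Mathlib

open MeasureTheory

/-- The `g`-weighted integral of a function bounded by `C` is at most `C` times the mass of `g`. -/
lemma integral_mul_le_integral_abs_mul {Ω : Type*} [MeasurableSpace Ω] {μ : Measure Ω}
    {g F : Ω → ℝ} {C : ℝ} (hg : Integrable g μ) (hgF : Integrable (fun m => g m * F m) μ)
    (hF : ∀ m, |F m| ≤ C) : ∫ m, g m * F m ∂μ ≤ (∫ m, |g m| ∂μ) * C := by
  rw [← integral_mul_const]
  refine integral_mono hgF (hg.abs.mul_const C) fun m => ?_
  calc g m * F m ≤ |g m * F m| := le_abs_self _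
    _ = |g m| * |F m| := abs_mul _ _
    _ ≤ |g m| * C := by gcongr; exact hF m

/-- If `|F| + |G| ≤ 1` at any two points, then the conditional averages of `F` and `G` on the
complementary events weighted by `g` and `h` sum to at most one. -/
lemma integral_div_add_integral_div_le_one {Ω : Type*} [MeasurableSpace Ω] {μ : Measure Ω}
    {g h F G : Ω → ℝ} (hg : Integrable g μ) (hh : Integrable h μ)
    (hgF : Integrable (fun m => g m * F m) μ) (hhG : Integrable (fun m => h m * G m) μ)
    (hFG : ∀ m m', |F m| + |G m'| ≤ 1)
    (hg0 : 0 < ∫ m, |g m| ∂μ) (hh0 : 0 < ∫ m, |h m| ∂μ) :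
    (∫ m, g m * F m ∂μ) / (∫ m, |g m| ∂μ) + (∫ m, h m * G m ∂μ) / (∫ m, |h m| ∂μ) ≤ 1 := by
  have hG (m' : Ω) : |G m'| ≤ 1 - (∫ m, g m * F m ∂μ) / (∫ m, |g m| ∂μ) := by
    have hle : (∫ m, g m * F m ∂μ) / (∫ m, |g m| ∂μ) ≤ 1 - |G m'| := by
      rw [div_le_iff₀' hg0]
      exact integral_mul_le_integral_abs_mul hg hgF fun m => by linarith [hFG m m']
    linarith
  have hle := (div_le_iff₀' hh0).2 (integral_mul_le_integral_abs_mul hh hhG hG)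
  linarith

/-- In a local model whose party `k` may receive the value `m` of an extra variable, replacing
`m` and the sign of the response of `k` independently on the two parts of a partition of the
inputs of `k` yields another local model, so the Bell inequality applies to it. -/
lemma bell_partition_abs_add_abs_le_one {M N : ℕ}
    {X : Fin M → Type} [∀ j, Fintype (X j)] {conn : Fin N → Fin M → Prop} {k : Fin M}
    {β : (∀ j, X j) → ℝ} {Λ : Fin N → Type} [∀ i, MeasurableSpace (Λ i)]
    {ρ : ∀ i, Measure (Λ i)} {Μt : Type} [MeasurableSpace Μt]
    {a : ∀ j : Fin M, X j → (∀ i, Λ i) → Μt → ℝ}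
    (hBell : ∀ a : ∀ j : Fin M, X j → (∀ i, Λ i) → ℝ,
      (∀ j x, Measurable (a j x)) →
      (∀ j x lam, a j x lam = 1 ∨ a j x lam = -1) →
      (∀ j x lam lam', (∀ i, conn i j → lam i = lam' i) → a j x lam = a j x lam') →
      ∑ x : ∀ j, X j, β x * ∫ lam, ∏ j, a j (x j) lam ∂(Measure.pi ρ) ≤ 1)
    (ha_meas : ∀ j x, Measurable (fun p : (∀ i, Λ i) × Μt => a j x p.1 p.2))
    (ha_val : ∀ j x lam m, a j x lam m = 1 ∨ a j x lam m = -1)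
    (ha_loc : ∀ j x lam lam' m m', (∀ i, conn i j → lam i = lam' i) →
      (j = k → m = m') → a j x lam m = a j x lam' m')
    (s : X k → Bool) (m m' : Μt) :
    |∑ x : ∀ j, X j, if s (x k) then
        β x * ∫ lam, ∏ j, a j (x j) lam m ∂(Measure.pi ρ) else 0|
      + |∑ x : ∀ j, X j, if s (x k) then 0 else
        β x * ∫ lam, ∏ j, a j (x j) lam m' ∂(Measure.pi ρ)| ≤ 1 := by
  have key (ε ε' : ℝ) (hε : ε = 1 ∨ ε = -1) (hε' : ε' = 1 ∨ ε' = -1) :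
      ε * (∑ x : ∀ j, X j, if s (x k) then
        β x * ∫ lam, ∏ j, a j (x j) lam m ∂(Measure.pi ρ) else 0)
      + ε' * (∑ x : ∀ j, X j, if s (x k) then 0 else
        β x * ∫ lam, ∏ j, a j (x j) lam m' ∂(Measure.pi ρ)) ≤ 1 := by
    let c : ∀ j, X j → ℝ := Function.update (fun _ _ => 1) k fun x => if s x then ε else ε'
    let t : ∀ j, X j → Μt := Function.update (fun _ _ => m) k fun x => if s x then m else m'
    have hc (j) (x : X j) : c j x = 1 ∨ c j x = -1 := by
      by_cases hj : j = k
      · subst hj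
        simp only [c, Function.update_self]
        split_ifs <;> assumption
      · simp [c, hj]
    have hc_prod (x : ∀ j, X j) : ∏ j, c j (x j) = if s (x k) then ε else ε' := by
      rw [Finset.prod_eq_single k (fun j _ hj => by simp [c, hj]) (by simp)]
      simp [c]
    have ht (x : ∀ j, X j) (lam) (j) :
        a j (x j) lam (t j (x j)) = a j (x j) lam (if s (x k) then m else m') := by
      refine ha_loc _ _ _ _ _ _ (fun _ _ => rfl) fun hj => ?_
      subst hj
      simp [t]
    have hle := hBell (fun j x lam => c j x * a j x lam (t j x))
      (fun j x => ((ha_meas j x).comp measurable_prodMk_right).const_mul _)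
      (fun j x lam => by
        rcases hc j x with h | h <;> rcases ha_val j x lam (t j x) with h' | h' <;>
          simp [h, h'])
      (fun j x lam lam' h => by rw [ha_loc j x lam lam' _ _ h fun _ => rfl])
    refine le_trans (le_of_eq ?_) hle
    rw [Finset.mul_sum, Finset.mul_sum, ← Finset.sum_add_distrib]
    refine Finset.sum_congr rfl fun x _ => ?_
    simp only [Finset.prod_mul_distrib, hc_prod, ht, integral_const_mul]
    split_ifs <;> ring
  have h1 := key 1 1 (by simp) (by simp)
  have h2 := key 1 (-1) (by simp) (by simp)
  have h3 := key (-1) 1 (by simp) (by simp)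
  have h4 := key (-1) (-1) (by simp) (by simp)
  rcases abs_cases (∑ x : ∀ j, X j, if s (x k) then
        β x * ∫ lam, ∏ j, a j (x j) lam m ∂(Measure.pi ρ) else 0) with h | h <;>
    rcases abs_cases (∑ x : ∀ j, X j, if s (x k) then 0 else
        β x * ∫ lam, ∏ j, a j (x j) lam m' ∂(Measure.pi ρ)) with h' | h' <;>
    linarith

/-- Fubini for a finite linear combination of bounded correlators. -/
lemma sum_mul_integral_prod_eq {ι Ω Ω' : Type*} [Fintype ι] [MeasurableSpace Ω]
    [MeasurableSpace Ω'] {ν : Measure Ω} {μ : Measure Ω'} [IsFiniteMeasure ν]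
    [IsFiniteMeasure μ] {f : ι → Ω → Ω' → ℝ} {g : Ω' → ℝ} (w : ι → ℝ)
    (hf : ∀ x, Measurable fun p : Ω × Ω' => f x p.1 p.2) (hg : Measurable g)
    (hf1 : ∀ x l m, |f x l m| ≤ 1) (hg1 : ∀ m, |g m| ≤ 1) :
    Integrable (fun m => g m * ∑ x, w x * ∫ l, f x l m ∂ν) μ ∧
    ∑ x, w x * ∫ p, f x p.1 p.2 * g p.2 ∂(ν.prod μ)
      = ∫ m, g m * ∑ x, w x * ∫ l, f x l m ∂ν ∂μ := by
  have hint (x : ι) : Integrable (fun p : Ω × Ω' => f x p.1 p.2 * g p.2) (ν.prod μ) := by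
    refine Integrable.of_bound ((hf x).mul (hg.comp measurable_snd)).aestronglyMeasurable 1
      (.of_forall fun p => ?_)
    rw [Real.norm_eq_abs, abs_mul]
    exact mul_le_one₀ (hf1 x _ _) (abs_nonneg _) (hg1 _)
  have heq : (fun m => g m * ∑ x, w x * ∫ l, f x l m ∂ν)
      = fun m => ∑ x, w x * ∫ l, f x l m * g m ∂ν := by
    funext m
    rw [Finset.mul_sum]
    refine Finset.sum_congr rfl fun x _ => ?_
    rw [integral_mul_const]
    ring
  have hint' (x : ι) : Integrable (fun m => w x * ∫ l, f x l m * g m ∂ν) μ :=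
    (hint x).integral_prod_right.const_mul _
  rw [heq]
  refine ⟨integrable_finsetSum _ fun x _ => hint' x, ?_⟩
  rw [integral_finsetSum _ fun x _ => hint' x]
  refine Finset.sum_congr rfl fun x _ => ?_
  rw [integral_const_mul, integral_prod_symm _ (hint x)]

/-- **Main theorem (full-correlation version).** Let a network `𝒩` consist of `M` parties
(indexed by `Fin M`, with finite input sets `X j` and ±1-valued outputs) and `N` independent
sources (indexed by `Fin N`), where `conn i j` means that source `i` is connected to party `j`,
and let `lastP` be the distinguished party `A^M`. Suppose the real coefficients `β` are such
that every `𝒩`-local model — measurable ±1-valued response functions depending only on the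
variables of the sources connected to each party, with the sources' variables distributed
independently — satisfies the full-correlation Bell inequality
`∑_x β x ⟨a¹_{x¹} ⋯ a^M_{x^M}⟩ ≤ 1`.
Form `𝒩′` by adding one new source `S_{N+1}` (variable space `Μt` with measure `μ`) connected
exactly to party `A^M` and to one new party `A^{M+1}` with binary inputs and ±1-valued
outputs `b`. Then every `𝒩′`-local model satisfies: either there exists `q ∈ (0,1)` such that
for every partition of `A^M`'s input set into subsets `X₊ = s⁻¹(true)` and `X₋ = s⁻¹(false)`
one has `(1/q)·Σ_{X₊} + (1/(1−q))·Σ_{X₋} ≤ 1`, where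
`Σ_{X±} = ∑_{x, x^M ∈ X±} β x ⟨a¹_{x¹} ⋯ a^M_{x^M} (a^{M+1}_0 ± a^{M+1}_1)/2⟩`;
or for every such partition `Σ_{X₋} = 0` and `Σ_{X₊} ≤ 1`; or for every such partition
`Σ_{X₊} = 0` and `Σ_{X₋} ≤ 1`. -/
theorem network_bell_inequality_extension
    (M N : ℕ)
    (X : Fin M → Type) [∀ j, Fintype (X j)]
    (conn : Fin N → Fin M → Prop)
    (lastP : Fin M) (hlast : (lastP : ℕ) + 1 = M)
    (β : (∀ j, X j) → ℝ)
    (hBell : ∀ (Λ : Fin N → Type) [∀ i, MeasurableSpace (Λ i)]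
      (ρ : ∀ i, Measure (Λ i)) [∀ i, IsProbabilityMeasure (ρ i)]
      (a : ∀ j : Fin M, X j → (∀ i, Λ i) → ℝ),
      (∀ j x, Measurable (a j x)) →
      (∀ j x lam, a j x lam = 1 ∨ a j x lam = -1) →
      (∀ j x lam lam', (∀ i, conn i j → lam i = lam' i) → a j x lam = a j x lam') →
      ∑ x : ∀ j, X j, β x * ∫ lam, ∏ j, a j (x j) lam ∂(Measure.pi ρ) ≤ 1)
    -- an `𝒩′`-local model:
    (Λ : Fin N → Type) [∀ i, MeasurableSpace (Λ i)]
    (ρ : ∀ i, Measure (Λ i)) [∀ i, IsProbabilityMeasure (ρ i)]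
    (Μt : Type) [MeasurableSpace Μt] (μ : Measure Μt) [IsProbabilityMeasure μ]
    (a : ∀ j : Fin M, X j → (∀ i, Λ i) → Μt → ℝ)
    (b : Fin 2 → Μt → ℝ)
    (ha_meas : ∀ j x, Measurable (fun p : (∀ i, Λ i) × Μt => a j x p.1 p.2))
    (hb_meas : ∀ y, Measurable (b y))
    (ha_val : ∀ j x lam m, a j x lam m = 1 ∨ a j x lam m = -1)
    (hb_val : ∀ y m, b y m = 1 ∨ b y m = -1)
    (ha_loc : ∀ j x lam lam' m m', (∀ i, conn i j → lam i = lam' i) →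
      (j = lastP → m = m') → a j x lam m = a j x lam' m') :
    (∃ q ∈ Set.Ioo (0:ℝ) 1, ∀ s : X lastP → Bool,
      (1/q) * (∑ x : ∀ j, X j, if s (x lastP) then
            β x * ∫ p, (∏ j, a j (x j) p.1 p.2) * ((b 0 p.2 + b 1 p.2) / 2)
              ∂((Measure.pi ρ).prod μ)
          else 0)
        + (1/(1-q)) * (∑ x : ∀ j, X j, if s (x lastP) then 0 else
            β x * ∫ p, (∏ j, a j (x j) p.1 p.2) * ((b 0 p.2 - b 1 p.2) / 2)
              ∂((Measure.pi ρ).prod μ)) ≤ 1)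
    ∨ (∀ s : X lastP → Bool,
        (∑ x : ∀ j, X j, if s (x lastP) then 0 else
            β x * ∫ p, (∏ j, a j (x j) p.1 p.2) * ((b 0 p.2 - b 1 p.2) / 2)
              ∂((Measure.pi ρ).prod μ)) = 0
        ∧ (∑ x : ∀ j, X j, if s (x lastP) then
              β x * ∫ p, (∏ j, a j (x j) p.1 p.2) * ((b 0 p.2 + b 1 p.2) / 2)
                ∂((Measure.pi ρ).prod μ)
            else 0) ≤ 1)
    ∨ (∀ s : X lastP → Bool,
        (∑ x : ∀ j, X j, if s (x lastP) then
            β x * ∫ p, (∏ j, a j (x j) p.1 p.2) * ((b 0 p.2 + b 1 p.2) / 2)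
              ∂((Measure.pi ρ).prod μ)
          else 0) = 0
        ∧ (∑ x : ∀ j, X j, if s (x lastP) then 0 else
              β x * ∫ p, (∏ j, a j (x j) p.1 p.2) * ((b 0 p.2 - b 1 p.2) / 2)
                ∂((Measure.pi ρ).prod μ)) ≤ 1) := by
  set g : Μt → ℝ := fun m => (b 0 m + b 1 m) / 2 with hg_def
  set h : Μt → ℝ := fun m => (b 0 m - b 1 m) / 2 with hh_def
  have hg_meas : Measurable g := ((hb_meas 0).add (hb_meas 1)).div_const 2
  have hh_meas : Measurable h := ((hb_meas 0).sub (hb_meas 1)).div_const 2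
  have hgh (m) : |g m| + |h m| = 1 := by
    rcases hb_val 0 m with h0 | h0 <;> rcases hb_val 1 m with h1 | h1 <;>
      norm_num [hg_def, hh_def, h0, h1]
  have hg1 (m) : |g m| ≤ 1 := by linarith [hgh m, abs_nonneg (h m)]
  have hh1 (m) : |h m| ≤ 1 := by linarith [hgh m, abs_nonneg (g m)]
  have hg_int : Integrable g μ :=
    .of_bound hg_meas.aestronglyMeasurable 1 (.of_forall hg1)
  have hh_int : Integrable h μ :=
    .of_bound hh_meas.aestronglyMeasurable 1 (.of_forall hh1)
  have hgh_int : (∫ m, |g m| ∂μ) + ∫ m, |h m| ∂μ = 1 := by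
    rw [← integral_add hg_int.abs hh_int.abs]
    simp [hgh]
  have hprod_meas (x : ∀ j, X j) :
      Measurable fun p : (∀ i, Λ i) × Μt => ∏ j, a j (x j) p.1 p.2 :=
    Finset.measurable_fun_prod _ fun j _ => ha_meas j (x j)
  have hprod1 (x : ∀ j, X j) (lam m) : |∏ j, a j (x j) lam m| ≤ 1 := by
    rw [Finset.abs_prod]
    refine Finset.prod_le_one (fun _ _ => abs_nonneg _) fun j _ => ?_
    rcases ha_val j (x j) lam m with h | h <;> simp [h]
  let F (s : X lastP → Bool) (m : Μt) : ℝ := ∑ x : ∀ j, X j, if s (x lastP) then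
    β x * ∫ lam, ∏ j, a j (x j) lam m ∂(Measure.pi ρ) else 0
  let G (s : X lastP → Bool) (m : Μt) : ℝ := ∑ x : ∀ j, X j, if s (x lastP) then 0 else
    β x * ∫ lam, ∏ j, a j (x j) lam m ∂(Measure.pi ρ)
  have hFG (s) (m m') : |F s m| + |G s m'| ≤ 1 :=
    bell_partition_abs_add_abs_le_one (hBell Λ ρ) ha_meas ha_val ha_loc s m m'
  have hF (s : X lastP → Bool) := sum_mul_integral_prod_eq (ν := Measure.pi ρ) (μ := μ)
    (fun x => if s (x lastP) then β x else 0) hprod_meas hg_meas hprod1 hg1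
  have hG (s : X lastP → Bool) := sum_mul_integral_prod_eq (ν := Measure.pi ρ) (μ := μ)
    (fun x => if s (x lastP) then 0 else β x) hprod_meas hh_meas hprod1 hh1
  simp only [ite_mul, zero_mul] at hF hG
  change ∀ s, Integrable (fun m => g m * F s m) μ ∧ _ = ∫ m, g m * F s m ∂μ at hF
  change ∀ s, Integrable (fun m => h m * G s m) μ ∧ _ = ∫ m, h m * G s m ∂μ at hG
  have abs_le (f H : Μt → ℝ) (hf : Integrable f μ) (hfH : Integrable (fun m => f m * H m) μ)
      (hH : ∀ m, |H m| ≤ 1) : |∫ m, f m * H m ∂μ| ≤ ∫ m, |f m| ∂μ := by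
    have hle := integral_mul_le_integral_abs_mul hf hfH hH
    have hle' := integral_mul_le_integral_abs_mul hf.neg
      (by simpa using hfH.neg) (F := H) hH
    simp only [Pi.neg_apply, neg_mul, integral_neg, abs_neg] at hle'
    exact abs_le'.2 ⟨by linarith, by linarith⟩
  have hF_abs (s) := abs_le g (F s) hg_int (hF s).1 fun m => by
    linarith [hFG s m m, abs_nonneg (G s m)]
  have hG_abs (s) := abs_le h (G s) hh_int (hG s).1 fun m => by
    linarith [hFG s m m, abs_nonneg (F s m)]
  have hg0 : 0 ≤ ∫ m, |g m| ∂μ := integral_nonneg fun _ => abs_nonneg _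
  have hh0 : 0 ≤ ∫ m, |h m| ∂μ := integral_nonneg fun _ => abs_nonneg _
  have hF_eq (s : X lastP → Bool) : (∑ x : ∀ j, X j, if s (x lastP) then
      β x * ∫ p, (∏ j, a j (x j) p.1 p.2) * ((b 0 p.2 + b 1 p.2) / 2)
        ∂((Measure.pi ρ).prod μ) else 0) = ∫ m, g m * F s m ∂μ := (hF s).2
  have hG_eq (s : X lastP → Bool) : (∑ x : ∀ j, X j, if s (x lastP) then 0 else
      β x * ∫ p, (∏ j, a j (x j) p.1 p.2) * ((b 0 p.2 - b 1 p.2) / 2)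
        ∂((Measure.pi ρ).prod μ)) = ∫ m, h m * G s m ∂μ := (hG s).2
  simp only [hF_eq, hG_eq]
  rcases hg0.eq_or_lt with hg0 | hg0
  · refine .inr (.inr fun s => ⟨abs_nonpos_iff.1 ((hF_abs s).trans hg0.ge), ?_⟩)
    linarith [(le_abs_self _).trans (hG_abs s)]
  rcases hh0.eq_or_lt with hh0 | hh0
  · refine .inr (.inl fun s => ⟨abs_nonpos_iff.1 ((hG_abs s).trans hh0.ge), ?_⟩)
    linarith [(le_abs_self _).trans (hF_abs s)]
  refine .inl ⟨∫ m, |g m| ∂μ, ⟨hg0, by linarith⟩, fun s => ?_⟩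
  have hle := integral_div_add_integral_div_le_one hg_int hh_int (hF s).1 (hG s).1 (hFG s)
    hg0 hh0
  rw [one_div_mul_eq_div, one_div_mul_eq_div, ← hgh_int, add_sub_cancel_left, hgh_int]
  exact hle
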